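/- Let R denote the commutative ring ℤ[w,z]/(w² − 2w, w − 2z + z²), the quotient of the polynomial ring over ℤ in two variables w, z by the ideal generated by w² − 2w and w − 2z + z². Then for every x ∈ R and every natural number k, the equation w·x = 2^k·w holds in R if and only if the equation w·(z·(w + z − w·z))·x = 2^{k+1}·w holds in R. -/

import Mathlib

open MvPolynomial

/-- The ideal `(w² - 2w, w - 2z + z²)` of `ℤ[w,z]`, where `w = X 0`, `z = X 1`. -/
noncomputable def reprIdeal : Ideal (MvPolynomial (Fin 2) ℤ) :=
  Ideal.span {(X 0 : MvPolynomial (Fin 2) ℤ) ^ 2 - 2 * X 0,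
    (X 0 : MvPolynomial (Fin 2) ℤ) - 2 * X 1 + (X 1) ^ 2}

/-- The class of `w` in `ℤ[w,z]/(w² - 2w, w - 2z + z²)`. -/
noncomputable def wQ : MvPolynomial (Fin 2) ℤ ⧸ reprIdeal :=
  Ideal.Quotient.mk reprIdeal (X 0)

/-- The class of `z` in `ℤ[w,z]/(w² - 2w, w - 2z + z²)`. -/
noncomputable def zQ : MvPolynomial (Fin 2) ℤ ⧸ reprIdeal :=
  Ideal.Quotient.mk reprIdeal (X 1)

theorem wQ_sq : wQ ^ 2 = 2 * wQ := by
  have h : Ideal.Quotient.mk reprIdeal (X 0 ^ 2 - 2 * X 0) = 0 :=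
    Ideal.Quotient.eq_zero_iff_mem.2 (Ideal.subset_span (by simp))
  rw [map_sub, map_pow, map_mul, map_ofNat] at h
  exact sub_eq_zero.1 h

theorem zQ_sq : zQ ^ 2 = 2 * zQ - wQ := by
  have h : Ideal.Quotient.mk reprIdeal (X 0 - 2 * X 1 + X 1 ^ 2) = 0 :=
    Ideal.Quotient.eq_zero_iff_mem.2 (Ideal.subset_span (by simp))
  rw [map_add, map_sub, map_pow, map_mul, map_ofNat] at h
  change wQ - 2 * zQ + zQ ^ 2 = 0 at h
  linear_combination h

/-- The ideal generated by `w` is spanned over `ℤ` by `w` and `w * z`. -/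
theorem exists_wQ_mul_eq (y : MvPolynomial (Fin 2) ℤ ⧸ reprIdeal) :
    ∃ a b : ℤ, wQ * y = a * wQ + b * (wQ * zQ) := by
  obtain ⟨p, rfl⟩ := Ideal.Quotient.mk_surjective y
  induction p using MvPolynomial.induction_on with
  | C n => exact ⟨n, 0, by simp [mul_comm]⟩
  | add p q hp hq =>
    obtain ⟨a, b, h⟩ := hp
    obtain ⟨c, d, h'⟩ := hq
    refine ⟨a + c, b + d, ?_⟩
    rw [map_add]
    push_cast
    linear_combination h + h'
  | mul_X p i hp =>
    obtain ⟨a, b, h⟩ := hp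
    rw [map_mul]
    fin_cases i
    · refine ⟨2 * a, 2 * b, ?_⟩
      change wQ * (_ * wQ) = _
      push_cast
      linear_combination wQ * h + (a + b * zQ) * wQ_sq
    · refine ⟨-2 * b, a + 2 * b, ?_⟩
      change wQ * (_ * zQ) = _
      push_cast
      linear_combination zQ * h + b * wQ * zQ_sq - b * wQ_sq

theorem reprIdeal_le_ker : reprIdeal ≤ RingHom.ker
    (eval₂Hom (Int.castRingHom GaussianInt) ![⟨2, 0⟩, ⟨1, -1⟩]) := by
  refine Ideal.span_le.2 ?_
  rintro p (rfl | rfl) <;>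
    simp only [SetLike.mem_coe, RingHom.mem_ker, map_add, map_sub, map_mul, map_pow,
      map_ofNat, coe_eval₂Hom, eval₂_X, Matrix.cons_val_zero, Matrix.cons_val_one] <;>
    decide

/-- Evaluation at the character value `w ↦ 2`, `z ↦ 1 - i`. -/
noncomputable def evalGaussian : MvPolynomial (Fin 2) ℤ ⧸ reprIdeal →+* GaussianInt :=
  Ideal.Quotient.lift reprIdeal
    (eval₂Hom (Int.castRingHom GaussianInt) ![⟨2, 0⟩, ⟨1, -1⟩])
    fun _ ha => RingHom.mem_ker.1 (reprIdeal_le_ker ha)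

theorem evalGaussian_wQ : evalGaussian wQ = ⟨2, 0⟩ := by
  rw [evalGaussian, wQ, Ideal.Quotient.lift_mk]
  simp

theorem evalGaussian_zQ : evalGaussian zQ = ⟨1, -1⟩ := by
  rw [evalGaussian, zQ, Ideal.Quotient.lift_mk]
  simp

theorem wQ_mul_eq_zero_of_two_mul {y : MvPolynomial (Fin 2) ℤ ⧸ reprIdeal}
    (hy : 2 * (wQ * y) = 0) : wQ * y = 0 := by
  obtain ⟨a, b, h⟩ := exists_wQ_mul_eq y
  rw [h] at hy ⊢
  have h₀ := congrArg evalGaussian hy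
  simp only [map_mul, map_add, map_ofNat, map_intCast, map_zero, evalGaussian_wQ,
    evalGaussian_zQ, Zsqrtd.ext_iff] at h₀
  obtain ⟨hre, him⟩ := h₀
  simp at hre him
  obtain rfl : b = 0 := by lia
  obtain rfl : a = 0 := by lia
  simp

theorem wQ_mul_euler : wQ * (zQ * (wQ + zQ - wQ * zQ)) = 2 * wQ := by
  linear_combination (1 + zQ - zQ ^ 2) * wQ_sq - wQ * zQ_sq

/-- In `R = ℤ[w,z]/(w² - 2w, w - 2z + z²)`, for every `x ∈ R` and `k : ℕ`,
`w * x = 2^k * w` holds if and only if `w * (z * (w + z - w*z)) * x = 2^(k+1) * w`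
holds. -/
theorem suspension_k_shift (x : MvPolynomial (Fin 2) ℤ ⧸ reprIdeal) (k : ℕ) :
    wQ * x = 2 ^ k * wQ ↔
      wQ * (zQ * (wQ + zQ - wQ * zQ)) * x = 2 ^ (k + 1) * wQ := by
  rw [wQ_mul_euler]
  constructor
  · intro h
    linear_combination 2 * h
  · intro h
    have h₀ : wQ * (x - 2 ^ k) = 0 :=
      wQ_mul_eq_zero_of_two_mul (by linear_combination h)
    linear_combination h₀
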